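/- Let f : [0,∞) → ℝ be convex with f(1) = 0, let N ≥ 1 and c ∈ ℝ^N. Then sup{ Σ_{i∈[N]} q_i c_i : q ∈ Δ^N, (1/N) Σ_{i∈[N]} f(N q_i) ≤ 1 } = inf_{ν ≥ 0} [ ν + sup_{q ∈ Δ^N} Σ_{i∈[N]} ( q_i c_i − (ν/N) f(N q_i) ) ], i.e., the constrained f-divergence DRO problem equals the infimum over the Lagrange multiplier ν ≥ 0 of its regularized form. -/

import Mathlib

theorem exists_mult {E : Type*} [AddCommGroup E] [Module ℝ E] (S : Set E) (hS : Convex ℝ S)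
    (L D : E → ℝ) (hL : ConcaveOn ℝ S L) (hD : ConvexOn ℝ S D) (u : E) (hu : u ∈ S)
    (hDu : D u < 1) (P : ℝ) (hP : ∀ q ∈ S, D q ≤ 1 → L q ≤ P) :
    ∃ ν : ℝ, 0 ≤ ν ∧ ∀ q ∈ S, L q + ν * (1 - D q) ≤ P := by
  set A : Set ℝ := {a | ∃ q ∈ S, D q < 1 ∧ a = (P - L q) / (1 - D q)} with hA
  have hne : A.Nonempty := ⟨_, u, hu, hDu, rfl⟩
  have hA0 : ∀ a ∈ A, 0 ≤ a := by
    rintro a ⟨q, hq, hq1, rfl⟩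
    have := hP q hq hq1.le
    exact div_nonneg (by linarith) (by linarith)
  refine ⟨sInf A, le_csInf hne hA0, fun q hq => ?_⟩
  rcases lt_trichotomy (D q) 1 with h | h | h
  · have h1 : sInf A ≤ (P - L q) / (1 - D q) := csInf_le ⟨0, hA0⟩ ⟨q, hq, h, rfl⟩
    rw [le_div_iff₀ (by linarith)] at h1
    linarith
  · have := hP q hq h.le
    rw [h]; linarith
  · have h1 : (L q - P) / (D q - 1) ≤ sInf A := by
      apply le_csInf hne
      rintro a ⟨p, hp, hp1, rfl⟩
      rw [div_le_div_iff₀ (by linarith) (by linarith)]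
      have hd : 0 < D q - D p := by linarith
      set s := (D q - 1) / (D q - D p) with hs
      set t := (1 - D p) / (D q - D p) with ht
      have hs0 : 0 ≤ s := div_nonneg (by linarith) hd.le
      have ht0 : 0 ≤ t := div_nonneg (by linarith) hd.le
      have hst : s + t = 1 := by rw [hs, ht]; field_simp; ring
      have e1 : s * (D q - D p) = D q - 1 := by rw [hs]; field_simp
      have e2 : t * (D q - D p) = 1 - D p := by rw [ht]; field_simp
      have c1 := hD.2 hp hq hs0 ht0 hst
      have c2 := hL.2 hp hq hs0 ht0 hst
      simp only [smul_eq_mul] at c1 c2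
      have c3 : s * D p + t * D q = 1 := by
        rw [hs, ht]; field_simp; ring
      have c4 := hP _ (hS hp hq hs0 ht0 hst) (by linarith)
      have c5 : s * L p + t * L q ≤ P := by linarith
      have c6 := mul_le_mul_of_nonneg_right c5 hd.le
      have c7 : (s * L p + t * L q) * (D q - D p) = (D q - 1) * L p + (1 - D p) * L q := by
        rw [← e1, ← e2]; ring
      nlinarith
    rw [div_le_iff₀ (by linarith)] at h1
    linarith

/-- For convex `f : [0,∞) → ℝ` with `f(1) = 0`, the constrained
`f`-divergence DRO value over the probability simplex equals the infimum over the Lagrange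
multiplier `ν ≥ 0` of `ν +` the value of the regularized (penalized) problem:
`sup { Σ q_i c_i : q ∈ Δ^N, (1/N) Σ f(N q_i) ≤ 1 }
  = inf_{ν ≥ 0} [ ν + sup_{q ∈ Δ^N} Σ (q_i c_i − (ν/N) f(N q_i)) ]`. -/
theorem stmt7 {N : ℕ} (hN : 1 ≤ N) (f : ℝ → ℝ)
    (hf : ConvexOn ℝ (Set.Ici 0) f) (hf1 : f 1 = 0) (c : Fin N → ℝ) :
    sSup {v : ℝ | ∃ q ∈ stdSimplex ℝ (Fin N),
        (1 / (N : ℝ)) * ∑ i, f ((N : ℝ) * q i) ≤ 1 ∧ v = ∑ i, q i * c i} =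
    sInf {v : ℝ | ∃ ν : ℝ, 0 ≤ ν ∧
        v = ν + sSup {u : ℝ | ∃ q ∈ stdSimplex ℝ (Fin N),
          u = ∑ i, (q i * c i - (ν / (N : ℝ)) * f ((N : ℝ) * q i))}} := by
  have hN0 : (0 : ℝ) < N := by exact_mod_cast hN
  set S := stdSimplex ℝ (Fin N) with hS
  set L : (Fin N → ℝ) → ℝ := fun q => ∑ i, q i * c i with hLdef
  set D : (Fin N → ℝ) → ℝ := fun q => (1 / (N : ℝ)) * ∑ i, f ((N : ℝ) * q i) with hDdef
  have hSc : Convex ℝ S := convex_stdSimplex ℝ (Fin N)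
  have hLc : ConcaveOn ℝ S L := by
    refine ⟨hSc, fun x _ y _ a b _ _ _ => le_of_eq ?_⟩
    simp only [hLdef, smul_eq_mul, Finset.mul_sum, ← Finset.sum_add_distrib, Pi.add_apply,
      Pi.smul_apply]
    exact Finset.sum_congr rfl fun i _ => by ring
  have hDc : ConvexOn ℝ S D := by
    refine ⟨hSc, fun x hx y hy a b ha hb hab => ?_⟩
    have key : ∑ i, f ((N : ℝ) * (a • x + b • y) i) ≤
        ∑ i, (a * f ((N : ℝ) * x i) + b * f ((N : ℝ) * y i)) := by
      refine Finset.sum_le_sum fun i _ => ?_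
      have h := hf.2 (Set.mem_Ici.2 (mul_nonneg hN0.le (hx.1 i)))
        (Set.mem_Ici.2 (mul_nonneg hN0.le (hy.1 i))) ha hb hab
      simp only [smul_eq_mul] at h
      have e : (N : ℝ) * (a • x + b • y) i = a * (N * x i) + b * (N * y i) := by
        simp only [Pi.add_apply, Pi.smul_apply, smul_eq_mul]; ring
      rw [e]; exact h
    rw [Finset.sum_add_distrib, ← Finset.mul_sum, ← Finset.mul_sum] at key
    have := mul_le_mul_of_nonneg_left key (by positivity : (0 : ℝ) ≤ 1 / N)
    simp only [hDdef, smul_eq_mul]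
    linarith
  have hD0 : ∀ q ∈ S, 0 ≤ D q := by
    intro q hq
    have h := hf.map_sum_le (t := Finset.univ) (w := fun _ : Fin N => 1 / (N : ℝ))
      (p := fun i => (N : ℝ) * q i) (fun _ _ => by positivity)
      (by simp [hN0.ne']) (fun i _ => Set.mem_Ici.2 (mul_nonneg hN0.le (hq.1 i)))
    simp only [smul_eq_mul, ← Finset.mul_sum, hq.2] at h
    have e : 1 / (N : ℝ) * (N * 1) = 1 := by field_simp
    rw [e, hf1] at h
    exact h
  have hLb : ∀ q ∈ S, L q ≤ ∑ i, |c i| := by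
    intro q hq
    refine Finset.sum_le_sum fun i _ => ?_
    have h1 : q i ≤ 1 := by
      rw [← hq.2]
      exact Finset.single_le_sum (fun j _ => hq.1 j) (Finset.mem_univ i)
    have h2 := hq.1 i
    have := le_abs_self (c i)
    nlinarith [abs_nonneg (c i)]
  let u : Fin N → ℝ := fun _ => 1 / (N : ℝ)
  have hu : u ∈ S := ⟨fun _ => by positivity, by simp [u, hN0.ne']⟩
  have hDu : D u = 0 := by
    have e : (N : ℝ) * (1 / N) = 1 := by field_simp
    simp only [hDdef, u, e, hf1]; simp
  have hreg : ∀ (ν : ℝ) (q : Fin N → ℝ),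
      ∑ i, (q i * c i - (ν / (N : ℝ)) * f ((N : ℝ) * q i)) = L q - ν * D q := by
    intro ν q
    simp only [hLdef, hDdef, Finset.sum_sub_distrib, ← Finset.mul_sum]; ring
  simp only [hreg]
  set P := sSup {v : ℝ | ∃ q ∈ S, D q ≤ 1 ∧ v = L q} with hPdef
  change P = _
  have hP : ∀ q ∈ S, D q ≤ 1 → L q ≤ P := fun q hq h1 =>
    le_csSup ⟨∑ i, |c i|, by rintro _ ⟨q, hq, _, rfl⟩; exact hLb q hq⟩ ⟨q, hq, h1, rfl⟩
  have weak : ∀ v ∈ {v : ℝ | ∃ ν : ℝ, 0 ≤ ν ∧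
        v = ν + sSup {u : ℝ | ∃ q ∈ S, u = L q - ν * D q}}, P ≤ v := by
    rintro _ ⟨ν, hν, rfl⟩
    refine csSup_le ⟨_, u, hu, by rw [hDu]; exact zero_le_one, rfl⟩ ?_
    rintro _ ⟨q, hq, h1, rfl⟩
    have h2 : L q - ν * D q ≤ sSup {u : ℝ | ∃ q ∈ S, u = L q - ν * D q} := by
      refine le_csSup ⟨∑ i, |c i|, ?_⟩ ⟨q, hq, rfl⟩
      rintro _ ⟨q, hq, rfl⟩
      have := mul_nonneg hν (hD0 q hq)
      linarith [hLb q hq]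
    nlinarith
  apply le_antisymm
  · exact le_csInf ⟨_, 0, le_rfl, rfl⟩ weak
  · obtain ⟨ν, hν, h⟩ := exists_mult S hSc L D hLc hDc u hu (by rw [hDu]; exact zero_lt_one) P hP
    refine (csInf_le ⟨P, weak⟩ ⟨ν, hν, rfl⟩).trans ?_
    have : sSup {u : ℝ | ∃ q ∈ S, u = L q - ν * D q} ≤ P - ν := by
      refine csSup_le ⟨_, u, hu, rfl⟩ ?_
      rintro _ ⟨q, hq, rfl⟩
      linarith [h q hq]
    linarith
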